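/- arXiv:2512.16286 — 4 statements merged into one kernel-verified Lean document; each statement's English description precedes it below -/
import Mathlib

section
/- Energy identity for the two-phase one-velocity system with PDE pressure closure (equality form of estimate (3.6) for smooth periodic solutions with f = 0), exhibiting the extra relaxation dissipation. Let d ≥ 1, γ₊, γ₋ > 1, λ₊, λ₋ ∈ ℝ, μ̄ > 0, and let μ₊, μ₋ : (0,∞) → ℝ be smooth. Let α₊, α₋, ρ₊, ρ₋ : ℝ × ℝ^d → ℝ and u : ℝ × ℝ^d → ℝ^d be smooth ℤ^d-periodic functions with ρ₊ > 0, ρ₋ > 0, satisfying: α₊ + α₋ = 1; the mass equations ∂ₜ(α±ρ±) + div(α±ρ±u) = 0 for both phases; the PDE closure ∂ₜα₊ + u·∇α₊ = (1/μ̄)α₊α₋(ρ₊^{γ₊} − ρ₋^{γ₋}); and the momentum equation ∂ₜ((α₊ρ₊+α₋ρ₋)u) + div((α₊ρ₊+α₋ρ₋)u⊗u) + ∇(α₊ρ₊^{γ₊} + α₋ρ₋^{γ₋}) − 2 div((α₊μ₊(ρ₊)+α₋μ₋(ρ₋))D(u)) − ∇((α₊λ₊+α₋λ₋) div u) = 0.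 Then for every time t: d/dt ∫_{[0,1]^d} [ ½(α₊ρ₊+α₋ρ₋)|u|² + α₊ρ₊^{γ₊}/(γ₊−1) + α₋ρ₋^{γ₋}/(γ₋−1) ] dx + ∫_{[0,1]^d} [ 2(α₊μ₊(ρ₊)+α₋μ₋(ρ₋))|D(u)|² + (α₊λ₊+α₋λ₋)(div u)² + (1/μ̄)α₊α₋(ρ₊^{γ₊} − ρ₋^{γ₋})² ] dx = 0. -/
open MeasureTheory Real

noncomputable section

/-- A space–time point: time in `ℝ`, space in `ℝ^d`. -/
abbrev Pt (d : ℕ) := ℝ × (Fin d → ℝ)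

/-- Time derivative `∂ₜ f`. -/
def pt {d : ℕ} (f : Pt d → ℝ) (p : Pt d) : ℝ :=
  fderiv ℝ f p (1, 0)

/-- Spatial partial derivative `∂_{x i} f`. -/
def pd {d : ℕ} (i : Fin d) (f : Pt d → ℝ) (p : Pt d) : ℝ :=
  fderiv ℝ f p (0, Pi.single i 1)

/-- Spatial divergence of a vector field. -/
def divg {d : ℕ} (u : Pt d → Fin d → ℝ) (p : Pt d) : ℝ :=
  ∑ i, pd i (fun q => u q i) p

/-- Spatial Laplacian of a scalar function. -/
def lap {d : ℕ} (f : Pt d → ℝ) (p : Pt d) : ℝ :=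
  ∑ i, pd i (fun q => pd i f q) p

/-- `i`-th component of `div (r u ⊗ u)`, i.e. `∑ j ∂_{x j} (r u_i u_j)`. -/
def divT {d : ℕ} (r : Pt d → ℝ) (u : Pt d → Fin d → ℝ) (p : Pt d) (i : Fin d) : ℝ :=
  ∑ j, pd j (fun q => r q * u q i * u q j) p

/-- Symmetric gradient `D(u) = (∇u + (∇u)ᵀ)/2`. -/
def Dsym {d : ℕ} (u : Pt d → Fin d → ℝ) (p : Pt d) (i j : Fin d) : ℝ :=
  (pd j (fun q => u q i) p + pd i (fun q => u q j) p) / 2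

/-- Divergence of a matrix field, `i`-th component `∑ j ∂_{x j} M_{ij}`. -/
def divM {d : ℕ} (M : Pt d → Fin d → Fin d → ℝ) (p : Pt d) (i : Fin d) : ℝ :=
  ∑ j, pd j (fun q => M q i j) p

/-- `ℤ^d`-periodicity in the space variable. -/
def ZPeriodic {d : ℕ} (f : Pt d → ℝ) : Prop :=
  ∀ (k : Fin d → ℤ) (t : ℝ) (x : Fin d → ℝ), f (t, x + fun i => (k i : ℝ)) = f (t, x)

/-- `ℤ^d`-periodicity of a vector field. -/
def ZPeriodicVec {d : ℕ} (u : Pt d → Fin d → ℝ) : Prop :=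
  ∀ i, ZPeriodic (fun q => u q i)

/-- The unit cell `[0,1]^d`. -/
def cell (d : ℕ) : Set (Fin d → ℝ) := Set.Icc 0 1

section Calculus

variable {d : ℕ} {f g : Pt d → ℝ} {u : Pt d → Fin d → ℝ}

lemma pt_add (hf : Differentiable ℝ f) (hg : Differentiable ℝ g) (p : Pt d) :
    pt (fun q => f q + g q) p = pt f p + pt g p := by
  simp [pt, fderiv_fun_add (hf p) (hg p)]

lemma pd_add (i : Fin d) (hf : Differentiable ℝ f) (hg : Differentiable ℝ g) (p : Pt d) :
    pd i (fun q => f q + g q) p = pd i f p + pd i g p := by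
  simp [pd, fderiv_fun_add (hf p) (hg p)]

lemma pd_sub (i : Fin d) (hf : Differentiable ℝ f) (hg : Differentiable ℝ g) (p : Pt d) :
    pd i (fun q => f q - g q) p = pd i f p - pd i g p := by
  simp [pd, fderiv_fun_sub (hf p) (hg p)]

lemma pt_mul (hf : Differentiable ℝ f) (hg : Differentiable ℝ g) (p : Pt d) :
    pt (fun q => f q * g q) p = pt f p * g p + f p * pt g p := by
  simp [pt, fderiv_fun_mul (hf p) (hg p)]
  ring

lemma pd_mul (i : Fin d) (hf : Differentiable ℝ f) (hg : Differentiable ℝ g) (p : Pt d) :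
    pd i (fun q => f q * g q) p = pd i f p * g p + f p * pd i g p := by
  simp [pd, fderiv_fun_mul (hf p) (hg p)]
  ring

lemma pt_const_mul (c : ℝ) (hf : Differentiable ℝ f) (p : Pt d) :
    pt (fun q => c * f q) p = c * pt f p := by
  simp [pt, fderiv_const_mul (hf p)]

lemma pd_const_mul (i : Fin d) (c : ℝ) (hf : Differentiable ℝ f) (p : Pt d) :
    pd i (fun q => c * f q) p = c * pd i f p := by
  simp [pd, fderiv_const_mul (hf p)]

lemma pt_div_const (c : ℝ) (hf : Differentiable ℝ f) (p : Pt d) :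
    pt (fun q => f q / c) p = pt f p / c := by
  simp only [div_eq_inv_mul, pt_const_mul c⁻¹ hf]

lemma pd_div_const (i : Fin d) (c : ℝ) (hf : Differentiable ℝ f) (p : Pt d) :
    pd i (fun q => f q / c) p = pd i f p / c := by
  simp only [div_eq_inv_mul, pd_const_mul i c⁻¹ hf]

lemma pt_sum {ι : Type*} [Fintype ι] {F : ι → Pt d → ℝ} (hF : ∀ k, Differentiable ℝ (F k))
    (p : Pt d) : pt (fun q => ∑ k, F k q) p = ∑ k, pt (F k) p := by
  simp [pt, fderiv_fun_sum fun k _ => hF k p]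

lemma pd_sum {ι : Type*} [Fintype ι] (i : Fin d) {F : ι → Pt d → ℝ}
    (hF : ∀ k, Differentiable ℝ (F k)) (p : Pt d) :
    pd i (fun q => ∑ k, F k q) p = ∑ k, pd i (F k) p := by
  simp [pd, fderiv_fun_sum fun k _ => hF k p]

lemma pt_sq (hf : Differentiable ℝ f) (p : Pt d) :
    pt (fun q => f q ^ 2) p = 2 * f p * pt f p := by
  simp only [pow_two, pt_mul hf hf]
  ring

lemma pd_sq (i : Fin d) (hf : Differentiable ℝ f) (p : Pt d) :
    pd i (fun q => f q ^ 2) p = 2 * f p * pd i f p := by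
  simp only [pow_two, pd_mul i hf hf]
  ring

lemma pt_rpow (γ : ℝ) (hf : Differentiable ℝ f) (h0 : ∀ q, 0 < f q) (p : Pt d) :
    pt (fun q => f q ^ γ) p = γ * f p ^ (γ - 1) * pt f p := by
  simp [pt, ((hf p).hasFDerivAt.rpow_const (p := γ) (Or.inl (h0 p).ne')).fderiv]

lemma pd_rpow (i : Fin d) (γ : ℝ) (hf : Differentiable ℝ f) (h0 : ∀ q, 0 < f q) (p : Pt d) :
    pd i (fun q => f q ^ γ) p = γ * f p ^ (γ - 1) * pd i f p := by
  simp [pd, ((hf p).hasFDerivAt.rpow_const (p := γ) (Or.inl (h0 p).ne')).fderiv]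

lemma contDiff_pt (hf : ContDiff ℝ (⊤ : ℕ∞) f) : ContDiff ℝ (⊤ : ℕ∞) (pt f) :=
  (hf.fderiv_right (m := (⊤ : ℕ∞)) (by simp)).clm_apply contDiff_const

lemma contDiff_pd (i : Fin d) (hf : ContDiff ℝ (⊤ : ℕ∞) f) : ContDiff ℝ (⊤ : ℕ∞) (pd i f) :=
  (hf.fderiv_right (m := (⊤ : ℕ∞)) (by simp)).clm_apply contDiff_const

lemma divg_mul (hf : Differentiable ℝ f) (hu : ∀ i, Differentiable ℝ fun q => u q i) (p : Pt d) :
    divg (fun q j => f q * u q j) p = ∑ j, u p j * pd j f p + f p * divg u p := by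
  simp only [divg, pd_mul _ hf (hu _), Finset.sum_add_distrib, Finset.mul_sum]
  simp only [mul_comm]

lemma ZPeriodic.pd (i : Fin d) (hf : ZPeriodic f) : ZPeriodic (pd i f) := by
  intro k t x
  have h : (fun q : Pt d => f (q + (0, fun i => (k i : ℝ)))) = f := by
    funext q
    simpa [Prod.add_def] using hf k q.1 q.2
  have h2 := fderiv_comp_add_right (𝕜 := ℝ) (f := f) (x := (t, x))
    ((0 : ℝ), fun i => (k i : ℝ))
  rw [h] at h2
  simp only [_root_.pd, h2, Prod.mk_add_mk, add_zero]

lemma ZPeriodicVec.divg (hu : ZPeriodicVec u) : ZPeriodic (divg u) := fun k t x =>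
  Finset.sum_congr rfl fun i _ => (hu i).pd i k t x

end Calculus

section Integration

variable {d : ℕ}

lemma isCompact_cell : IsCompact (cell d) := isCompact_Icc

/-- The divergence of a smooth periodic vector field has zero mean. -/
lemma integral_divg_eq_zero (hd : 1 ≤ d) {F : Pt d → Fin d → ℝ}
    (hF : ∀ i, ContDiff ℝ (⊤ : ℕ∞) fun q => F q i) (hper : ZPeriodicVec F) (t : ℝ) :
    ∫ x in cell d, divg F (t, x) = 0 := by
  obtain ⟨n, rfl⟩ : ∃ n, d = n + 1 := ⟨d - 1, by omega⟩
  let J : (Fin (n + 1) → ℝ) →L[ℝ] Pt (n + 1) := ContinuousLinearMap.inr ℝ ℝ _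
  have hslice (x : Fin (n + 1) → ℝ) : HasFDerivAt (fun y => ((t, y) : Pt (n + 1))) J x :=
    hasFDerivAt_prodMk_right t x
  have hdiff (i) (x : Fin (n + 1) → ℝ) : HasFDerivAt (fun y => F (t, y) i)
      ((fderiv ℝ (fun q => F q i) (t, x)).comp J) x :=
    HasFDerivAt.comp (g := fun q => F q i) x
      (((hF i).differentiable (by simp)) (t, x)).hasFDerivAt (hslice x)
  have hcont : Continuous (divg F) :=
    continuous_finsetSum _ fun i _ => (contDiff_pd i (hF i)).continuous
  have key := integral_divergence_of_hasFDerivAt_off_countable' (a := (0 : Fin (n + 1) → ℝ))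
    (b := 1) zero_le_one (fun i y => F (t, y) i)
    (fun i x => (fderiv ℝ (fun q => F q i) (t, x)).comp J) ∅ Set.countable_empty
    (fun i x _ => (hdiff i x).continuousAt.continuousWithinAt)
    (fun x _ i => hdiff i x)
    ((hcont.comp (Continuous.prodMk_right t)).continuousOn.integrableOn_compact isCompact_cell)
  refine Eq.trans key (Finset.sum_eq_zero fun i _ => sub_eq_zero.2 ?_)
  congr 1
  funext y
  have := hper i (Pi.single i 1) t (i.insertNth 0 y)
  simp only at this
  simp only [Pi.one_apply, Pi.zero_apply]
  rw [← this]
  congr 2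
  ext j
  rcases Fin.eq_self_or_eq_succAbove i j with rfl | ⟨j, rfl⟩ <;> simp

/-- Differentiation under the integral sign over the unit cell. -/
lemma hasDerivAt_integral_cell {E : Pt d → ℝ} (hE : ContDiff ℝ (⊤ : ℕ∞) E) (t : ℝ) :
    HasDerivAt (fun s => ∫ x in cell d, E (s, x)) (∫ x in cell d, pt E (t, x)) t := by
  have hc : Continuous (pt E) := (contDiff_pt hE).continuous
  obtain ⟨C, hC⟩ := ((isCompact_Icc (a := t - 1) (b := t + 1)).prod
    (isCompact_cell (d := d))).exists_bound_of_continuousOn hc.continuousOn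
  refine (hasDerivAt_integral_of_dominated_loc_of_deriv_le (μ := volume.restrict (cell d))
    (F := fun s x => E (s, x)) (F' := fun s x => pt E (s, x)) (bound := fun _ => C)
    (Icc_mem_nhds (by linarith) (by linarith) : Set.Icc (t - 1) (t + 1) ∈ nhds t)
    ?_ ?_ ?_ ?_ ?_ ?_).2
  · exact .of_forall fun s =>
      (hE.continuous.comp (Continuous.prodMk_right s)).aestronglyMeasurable
  · exact (hE.continuous.comp (Continuous.prodMk_right t)).continuousOn.integrableOn_compact
      isCompact_cell
  · exact (hc.comp (Continuous.prodMk_right t)).aestronglyMeasurable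
  · exact (ae_restrict_mem isCompact_cell.measurableSet).mono fun x hx s hs => hC (s, x) ⟨hs, hx⟩
  · exact continuousOn_const.integrableOn_compact isCompact_cell
  · refine .of_forall fun x s _ => ?_
    have h1 : HasDerivAt (fun r : ℝ => ((r, x) : Pt d)) (1, 0) s :=
      (hasDerivAt_id s).prodMk (hasDerivAt_const s x)
    exact ((hE.differentiable (by simp)) (s, x)).hasFDerivAt.comp_hasDerivAt s h1

/-- A local balance law with smooth periodic flux integrates to a global one. -/
lemma deriv_integral_add_integral_eq_zero (hd : 1 ≤ d) {E Q : Pt d → ℝ} {F : Pt d → Fin d → ℝ}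
    (hE : ContDiff ℝ (⊤ : ℕ∞) E) (hF : ∀ i, ContDiff ℝ (⊤ : ℕ∞) fun q => F q i)
    (hper : ZPeriodicVec F) (h : ∀ p, pt E p + Q p = divg F p) (t : ℝ) :
    deriv (fun s => ∫ x in cell d, E (s, x)) t + ∫ x in cell d, Q (t, x) = 0 := by
  have hcE : Continuous fun x => pt E (t, x) :=
    (contDiff_pt hE).continuous.comp (Continuous.prodMk_right t)
  have hcF : Continuous fun x => divg F (t, x) :=
    (continuous_finsetSum _ fun i _ => (contDiff_pd i (hF i)).continuous).comp
      (Continuous.prodMk_right t)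
  have hQ : (fun x => Q (t, x)) = fun x => divg F (t, x) - pt E (t, x) := by
    funext x
    rw [← h]
    ring
  rw [(hasDerivAt_integral_cell hE t).deriv, hQ,
    integral_sub (hcF.continuousOn.integrableOn_compact isCompact_cell)
      (hcE.continuousOn.integrableOn_compact isCompact_cell),
    integral_divg_eq_zero hd hF hper]
  ring

end Integration

section Balance

variable {d : ℕ} {u : Pt d → Fin d → ℝ}

/-- Balance of the internal energy `α ρ ^ γ / (γ - 1)` of one phase. -/
lemma internal_energy_balance {γ : ℝ} (hγ : 1 < γ) {α ρ : Pt d → ℝ} (hα : Differentiable ℝ α)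
    (hρ : Differentiable ℝ ρ) (hu : ∀ i, Differentiable ℝ fun q => u q i) (h0 : ∀ q, 0 < ρ q)
    {p : Pt d} (hmass : pt (fun q => α q * ρ q) p + divg (fun q j => α q * ρ q * u q j) p = 0) :
    pt (fun q => α q * ρ q ^ γ / (γ - 1)) p
        + ∑ i, u p i * pd i (fun q => α q * ρ q ^ γ / (γ - 1)) p
        + α p * ρ p ^ γ / (γ - 1) * divg u p
      = -(ρ p ^ γ * (pt α p + ∑ i, u p i * pd i α p)) - α p * ρ p ^ γ * divg u p := by
  have hργ : Differentiable ℝ fun q => ρ q ^ γ := fun q =>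
    (hρ q).rpow_const (Or.inl (h0 q).ne')
  have hpow : ρ p ^ γ = ρ p ^ (γ - 1) * ρ p := by
    rw [← Real.rpow_add_one (h0 p).ne', sub_add_cancel]
  have e1 : ∑ i, u p i * pd i (fun q => α q * ρ q) p
      = (∑ i, u p i * pd i α p) * ρ p + α p * ∑ i, u p i * pd i ρ p := by
    rw [Finset.sum_mul, Finset.mul_sum, ← Finset.sum_add_distrib]
    exact Finset.sum_congr rfl fun i _ => by rw [pd_mul i hα hρ]; ring
  have e2 : ∑ i, u p i * pd i (fun q => α q * ρ q ^ γ / (γ - 1)) p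
      = ((∑ i, u p i * pd i α p) * ρ p ^ γ
        + α p * (γ * ρ p ^ (γ - 1)) * ∑ i, u p i * pd i ρ p) / (γ - 1) := by
    rw [Finset.sum_mul, Finset.mul_sum, ← Finset.sum_add_distrib, Finset.sum_div]
    exact Finset.sum_congr rfl fun i _ => by
      rw [pd_div_const i _ (hα.fun_mul hργ), pd_mul i hα hργ, pd_rpow i γ hρ h0]; ring
  rw [divg_mul (hα.fun_mul hρ) hu, pt_mul hα hρ, e1] at hmass
  rw [pt_div_const _ (hα.fun_mul hργ), pt_mul hα hργ, pt_rpow γ hρ h0, e2, hpow]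
  have hγ' : γ - 1 ≠ 0 := by linarith
  field_simp
  linear_combination (γ * ρ p ^ (γ - 1)) * hmass

/-- Balance of the kinetic energy `r |u|² / 2`. -/
lemma kinetic_energy_balance {r : Pt d → ℝ} (hr : Differentiable ℝ r)
    (hu : ∀ i, Differentiable ℝ fun q => u q i) {p : Pt d}
    (hmass : pt r p + divg (fun q j => r q * u q j) p = 0) :
    pt (fun q => 1 / 2 * r q * ∑ i, u q i ^ 2) p
        + ∑ j, u p j * pd j (fun q => 1 / 2 * r q * ∑ i, u q i ^ 2) p
        + 1 / 2 * r p * (∑ i, u p i ^ 2) * divg u p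
      = ∑ i, u p i * (pt (fun q => r q * u q i) p + divT r u p i) := by
  have hsq : Differentiable ℝ fun q => ∑ i, u q i ^ 2 :=
    Differentiable.fun_sum fun i _ => (hu i).pow 2
  have hr2 : Differentiable ℝ fun q => 1 / 2 * r q := hr.const_mul _
  rw [divg_mul hr hu] at hmass
  have hpt : pt (fun q => 1 / 2 * r q * ∑ i, u q i ^ 2) p
      = 1 / 2 * pt r p * (∑ i, u p i ^ 2) + r p * ∑ i, u p i * pt (fun q => u q i) p := by
    rw [pt_mul hr2 hsq, pt_const_mul _ hr, pt_sum fun i => (hu i).fun_pow 2]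
    simp only [pt_sq (hu _), mul_assoc (2 : ℝ), ← Finset.mul_sum]
    ring
  have hpd (j) : pd j (fun q => 1 / 2 * r q * ∑ i, u q i ^ 2) p
      = 1 / 2 * pd j r p * (∑ i, u p i ^ 2) + r p * ∑ i, u p i * pd j (fun q => u q i) p := by
    rw [pd_mul j hr2 hsq, pd_const_mul j _ hr, pd_sum j fun i => (hu i).fun_pow 2]
    simp only [pd_sq j (hu _), mul_assoc (2 : ℝ), ← Finset.mul_sum]
    ring
  have hT (i) : divT r u p i = u p i * (∑ j, u p j * pd j r p + r p * divg u p)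
      + r p * ∑ j, u p j * pd j (fun q => u q i) p := by
    have := divg_mul (f := fun q => r q * u q i) (hr.fun_mul (hu i)) hu p
    rw [divT]
    refine this.trans ?_
    simp only [pd_mul _ hr (hu i), mul_add, Finset.mul_sum, Finset.sum_add_distrib]
    rw [add_right_comm]
    congr 1
    · congr 1
      · exact Finset.sum_congr rfl fun j _ => by ring
      · ring
    · exact Finset.sum_congr rfl fun j _ => by ring
  have hR : ∑ i, u p i * (pt (fun q => r q * u q i) p + divT r u p i)
      = r p * (∑ i, u p i * pt (fun q => u q i) p)
        + r p * ∑ i, ∑ j, u p i * (u p j * pd j (fun q => u q i) p) := by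
    simp only [Finset.mul_sum, ← Finset.sum_add_distrib]
    refine Finset.sum_congr rfl fun i _ => ?_
    rw [pt_mul hr (hu i), hT]
    simp only [← Finset.mul_sum]
    linear_combination u p i ^ 2 * hmass
  have hL : ∑ j, u p j * pd j (fun q => 1 / 2 * r q * ∑ i, u q i ^ 2) p
      = 1 / 2 * (∑ j, u p j * pd j r p) * (∑ i, u p i ^ 2)
        + r p * ∑ i, ∑ j, u p i * (u p j * pd j (fun q => u q i) p) := by
    rw [Finset.sum_comm (γ := Fin d)]
    simp only [hpd, mul_add, Finset.sum_add_distrib, Finset.mul_sum (s := Finset.univ) (a := r p),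
      Finset.mul_sum (s := Finset.univ) (a := (1 / 2 : ℝ)), Finset.sum_mul]
    congr 1
    · exact Finset.sum_congr rfl fun j _ => by ring
    · refine Finset.sum_congr rfl fun j _ => ?_
      rw [Finset.mul_sum]
      exact Finset.sum_congr rfl fun i _ => by ring
  rw [hpt, hL, hR]
  linear_combination 1 / 2 * (∑ i, u p i ^ 2) * hmass

/-- The power of the stress `m D(u)`: a divergence minus the viscous dissipation. -/
lemma stress_power {m : Pt d → ℝ} (hu : ∀ i, Differentiable ℝ fun q => u q i)
    (hM : ∀ i j, Differentiable ℝ fun q => m q * Dsym u q i j) (p : Pt d) :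
    ∑ i, u p i * divM (fun q i j => m q * Dsym u q i j) p i
      = divg (fun q j => ∑ i, m q * Dsym u q i j * u q i) p
        - m p * ∑ i, ∑ j, Dsym u p i j ^ 2 := by
  have hdiv : divg (fun q j => ∑ i, m q * Dsym u q i j * u q i) p
      = ∑ i, u p i * divM (fun q i j => m q * Dsym u q i j) p i
        + m p * ∑ i, ∑ j, Dsym u p i j * pd j (fun q => u q i) p := by
    simp only [divg, divM, Finset.mul_sum]
    rw [← Finset.sum_add_distrib, Finset.sum_congr rfl fun j _ =>
      pd_sum j (fun i => (hM i j).fun_mul (hu i)) p, Finset.sum_comm]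
    refine Finset.sum_congr rfl fun i _ => ?_
    rw [← Finset.sum_add_distrib]
    exact Finset.sum_congr rfl fun j _ => by rw [pd_mul j (hM i j) (hu i)]; ring
  have hsymm : ∑ i, ∑ j, Dsym u p i j * pd j (fun q => u q i) p
      = ∑ i, ∑ j, Dsym u p i j * pd i (fun q => u q j) p := by
    rw [Finset.sum_comm]
    refine Finset.sum_congr rfl fun i _ => Finset.sum_congr rfl fun j _ => ?_
    rw [show Dsym u p j i = Dsym u p i j by simp only [Dsym, add_comm]]
  have hD : ∑ i, ∑ j, Dsym u p i j ^ 2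
      = (∑ i, ∑ j, Dsym u p i j * pd j (fun q => u q i) p
        + ∑ i, ∑ j, Dsym u p i j * pd i (fun q => u q j) p) / 2 := by
    simp only [← Finset.sum_add_distrib, Finset.sum_div]
    refine Finset.sum_congr rfl fun i _ => Finset.sum_congr rfl fun j _ => ?_
    rw [pow_two]
    nth_rewrite 2 [Dsym]
    ring
  rw [hdiv, hD, ← hsymm]
  ring

end Balance

/-- energy identity for the two-phase one-velocity system with PDE
pressure closure (equality form of estimate (3.6), `f = 0`), with the extra
relaxation dissipation term. -/
theorem energy_identity_PDE_closure
    {d : ℕ} (hd : 1 ≤ d) (γp γm lamp lamm μbar : ℝ) (hγp : 1 < γp) (hγm : 1 < γm)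
    (hμbar : 0 < μbar)
    (μp μm : ℝ → ℝ)
    (hμp : ContDiffOn ℝ (⊤ : ℕ∞) μp (Set.Ioi 0)) (hμm : ContDiffOn ℝ (⊤ : ℕ∞) μm (Set.Ioi 0))
    (αp αm ρp ρm : Pt d → ℝ) (u : Pt d → Fin d → ℝ)
    (hreg : ContDiff ℝ (⊤ : ℕ∞) αp ∧ ContDiff ℝ (⊤ : ℕ∞) αm ∧ ContDiff ℝ (⊤ : ℕ∞) ρp ∧ ContDiff ℝ (⊤ : ℕ∞) ρm ∧
      ContDiff ℝ (⊤ : ℕ∞) u)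
    (hper : ZPeriodic αp ∧ ZPeriodic αm ∧ ZPeriodic ρp ∧ ZPeriodic ρm ∧ ZPeriodicVec u)
    (hρp : ∀ p, 0 < ρp p) (hρm : ∀ p, 0 < ρm p)
    (hα : ∀ p, αp p + αm p = 1)
    (hmassp : ∀ p, pt (fun q => αp q * ρp q) p
      + divg (fun q j => αp q * ρp q * u q j) p = 0)
    (hmassm : ∀ p, pt (fun q => αm q * ρm q) p
      + divg (fun q j => αm q * ρm q * u q j) p = 0)
    (hclosure : ∀ p : Pt d, pt αp p + ∑ i, u p i * pd i αp p
      = (1 / μbar) * (αp p * αm p) * (ρp p ^ γp - ρm p ^ γm))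
    (hmom : ∀ p (i : Fin d),
      pt (fun q => (αp q * ρp q + αm q * ρm q) * u q i) p
      + divT (fun q => αp q * ρp q + αm q * ρm q) u p i
      + pd i (fun q => αp q * ρp q ^ γp + αm q * ρm q ^ γm) p
      - 2 * divM (fun q i j => (αp q * μp (ρp q) + αm q * μm (ρm q)) * Dsym u q i j) p i
      - pd i (fun q => (αp q * lamp + αm q * lamm) * divg u q) p = 0) :
    ∀ t : ℝ,
      deriv (fun s => ∫ x in cell d,
          ((1 / 2) * (αp (s, x) * ρp (s, x) + αm (s, x) * ρm (s, x))
              * ∑ i, (u (s, x) i) ^ 2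
            + αp (s, x) * ρp (s, x) ^ γp / (γp - 1)
            + αm (s, x) * ρm (s, x) ^ γm / (γm - 1))) t
      + (∫ x in cell d,
          (2 * (αp (t, x) * μp (ρp (t, x)) + αm (t, x) * μm (ρm (t, x)))
              * ∑ i, ∑ j, (Dsym u (t, x) i j) ^ 2
            + (αp (t, x) * lamp + αm (t, x) * lamm) * (divg u (t, x)) ^ 2
            + (1 / μbar) * (αp (t, x) * αm (t, x))
              * (ρp (t, x) ^ γp - ρm (t, x) ^ γm) ^ 2)) = 0 := by
  obtain ⟨hαps, hαms, hρps, hρms, hus⟩ := hreg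
  obtain ⟨hαpP, hαmP, hρpP, hρmP, huP⟩ := hper
  have hui (i) : ContDiff ℝ (⊤ : ℕ∞) fun q => u q i := contDiff_pi.1 hus i
  have hdivs : ContDiff ℝ (⊤ : ℕ∞) (divg u) := ContDiff.sum fun i _ => contDiff_pd i (hui i)
  have hDs (i j) : ContDiff ℝ (⊤ : ℕ∞) fun q => Dsym u q i j :=
    ((contDiff_pd j (hui i)).add (contDiff_pd i (hui j))).div_const 2
  have hcomp {μ : ℝ → ℝ} {ρ : Pt d → ℝ} (hμ : ContDiffOn ℝ (⊤ : ℕ∞) μ (Set.Ioi 0))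
      (hρ : ContDiff ℝ (⊤ : ℕ∞) ρ) (h0 : ∀ q, 0 < ρ q) :
      ContDiff ℝ (⊤ : ℕ∞) fun q => μ (ρ q) :=
    hμ.comp_contDiff hρ h0
  have hpp : ContDiff ℝ (⊤ : ℕ∞) fun q => αp q * ρp q ^ γp :=
    hαps.mul (hρps.rpow_const_of_ne fun q => (hρp q).ne')
  have hpm : ContDiff ℝ (⊤ : ℕ∞) fun q => αm q * ρm q ^ γm :=
    hαms.mul (hρms.rpow_const_of_ne fun q => (hρm q).ne')
  have hrs : ContDiff ℝ (⊤ : ℕ∞) fun q => αp q * ρp q + αm q * ρm q :=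
    (hαps.mul hρps).add (hαms.mul hρms)
  have hms : ContDiff ℝ (⊤ : ℕ∞) fun q => αp q * μp (ρp q) + αm q * μm (ρm q) :=
    (hαps.mul (hcomp hμp hρps hρp)).add (hαms.mul (hcomp hμm hρms hρm))
  have hls : ContDiff ℝ (⊤ : ℕ∞) fun q => (αp q * lamp + αm q * lamm) * divg u q :=
    ((hαps.mul contDiff_const).add (hαms.mul contDiff_const)).mul hdivs
  have hKs : ContDiff ℝ (⊤ : ℕ∞) fun q =>
      1 / 2 * (αp q * ρp q + αm q * ρm q) * ∑ i, u q i ^ 2 :=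
    (contDiff_const.mul hrs).mul (ContDiff.sum fun i _ => (hui i).pow 2)
  have hMs (i j) : ContDiff ℝ (⊤ : ℕ∞) fun q =>
      (αp q * μp (ρp q) + αm q * μm (ρm q)) * Dsym u q i j := hms.mul (hDs i j)
  have hSs (j) : ContDiff ℝ (⊤ : ℕ∞) fun q =>
      ∑ i, (αp q * μp (ρp q) + αm q * μm (ρm q)) * Dsym u q i j * u q i :=
    ContDiff.sum fun i _ => (hMs i j).mul (hui i)
  have hEs := (hKs.add (hpp.div_const (γp - 1))).add (hpm.div_const (γm - 1))
  have hWs := (hls.sub (hpp.add hpm)).sub hEs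
  have D {f : Pt d → ℝ} (hf : ContDiff ℝ (⊤ : ℕ∞) f) : Differentiable ℝ f :=
    hf.differentiable (by simp)
  refine deriv_integral_add_integral_eq_zero hd
    (E := fun q => 1 / 2 * (αp q * ρp q + αm q * ρm q) * ∑ i, u q i ^ 2
      + αp q * ρp q ^ γp / (γp - 1) + αm q * ρm q ^ γm / (γm - 1))
    (Q := fun q => 2 * (αp q * μp (ρp q) + αm q * μm (ρm q)) * ∑ i, ∑ j, Dsym u q i j ^ 2
      + (αp q * lamp + αm q * lamm) * divg u q ^ 2
      + 1 / μbar * (αp q * αm q) * (ρp q ^ γp - ρm q ^ γm) ^ 2)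
    (F := fun q j =>
      2 * (∑ i, (αp q * μp (ρp q) + αm q * μm (ρm q)) * Dsym u q i j * u q i)
      + ((αp q * lamp + αm q * lamm) * divg u q - (αp q * ρp q ^ γp + αm q * ρm q ^ γm)
        - (1 / 2 * (αp q * ρp q + αm q * ρm q) * ∑ i, u q i ^ 2
          + αp q * ρp q ^ γp / (γp - 1) + αm q * ρm q ^ γm / (γm - 1))) * u q j)
    hEs (fun j => (contDiff_const.mul (hSs j)).add (hWs.mul (hui j))) ?_ ?_
  · intro j k t x
    have hu' (i) := huP i k t x
    have hD' (i j) : Dsym u (t, x + fun i => (k i : ℝ)) i j = Dsym u (t, x) i j := by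
      simp only [Dsym, (huP _).pd _ k t x]
    simp only at hu'
    simp only [hαpP k t x, hαmP k t x, hρpP k t x, hρmP k t x, huP.divg k t x, hu', hD']
  intro p
  have hmass : pt (fun q => αp q * ρp q + αm q * ρm q) p
      + divg (fun q j => (αp q * ρp q + αm q * ρm q) * u q j) p = 0 := by
    have h1 := hmassp p
    have h2 := hmassm p
    rw [divg_mul (D (hαps.mul hρps)) fun i => D (hui i)] at h1
    rw [divg_mul (D (hαms.mul hρms)) fun i => D (hui i)] at h2
    rw [divg_mul (D hrs) fun i => D (hui i), pt_add (D (hαps.mul hρps)) (D (hαms.mul hρms))]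
    simp only [pd_add _ (D (hαps.mul hρps)) (D (hαms.mul hρms)), mul_add, Finset.sum_add_distrib]
    linear_combination h1 + h2
  have hK := kinetic_energy_balance (D hrs) (fun i => D (hui i)) hmass
  have hIp := internal_energy_balance hγp (D hαps) (D hρps) (fun i => D (hui i)) hρp (hmassp p)
  have hIm := internal_energy_balance hγm (D hαms) (D hρms) (fun i => D (hui i)) hρm (hmassm p)
  have hαm_eq : αm = fun q => 1 - αp q := funext fun q => by linarith [hα q]
  have hclm : pt αm p + ∑ i, u p i * pd i αm p
      = -(pt αp p + ∑ i, u p i * pd i αp p) := by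
    have e1 : pt αm p = -pt αp p := by simp [hαm_eq, pt, fderiv_const_sub]
    have e2 (i) : pd i αm p = -pd i αp p := by simp [hαm_eq, pd, fderiv_const_sub]
    simp only [e1, e2, mul_neg, Finset.sum_neg_distrib]
    ring
  rw [hclosure p] at hIp hclm
  rw [hclm] at hIm
  have hS := stress_power (m := fun q => αp q * μp (ρp q) + αm q * μm (ρm q))
    (fun i => D (hui i)) (fun i j => D (hMs i j)) p
  have hmom' : ∑ i, u p i * (pt (fun q => (αp q * ρp q + αm q * ρm q) * u q i) p
        + divT (fun q => αp q * ρp q + αm q * ρm q) u p i)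
      = 2 * (∑ i, u p i * divM (fun q i j =>
          (αp q * μp (ρp q) + αm q * μm (ρm q)) * Dsym u q i j) p i)
        + ∑ i, u p i * pd i (fun q => (αp q * lamp + αm q * lamm) * divg u q) p
        - ∑ i, u p i * pd i (fun q => αp q * ρp q ^ γp + αm q * ρm q ^ γm) p := by
    rw [Finset.mul_sum, ← Finset.sum_add_distrib, ← Finset.sum_sub_distrib]
    exact Finset.sum_congr rfl fun i _ => by linear_combination u p i * hmom p i
  have hflux : ∀ {S : Pt d → Fin d → ℝ} {W : Pt d → ℝ}, (∀ j, Differentiable ℝ fun q => S q j) →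
      Differentiable ℝ W → divg (fun q j => 2 * S q j + W q * u q j) p
        = 2 * divg S p + (∑ j, u p j * pd j W p + W p * divg u p) := by
    intro S W hS hW
    rw [← divg_mul hW fun i => D (hui i)]
    simp only [divg, Finset.mul_sum, ← Finset.sum_add_distrib]
    exact Finset.sum_congr rfl fun j _ => by
      rw [pd_add j ((hS j).const_mul 2) (hW.fun_mul (D (hui j))), pd_const_mul j 2 (hS j)]
  have hW : ∑ j, u p j * pd j (fun q => (αp q * lamp + αm q * lamm) * divg u q
        - (αp q * ρp q ^ γp + αm q * ρm q ^ γm)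
        - (1 / 2 * (αp q * ρp q + αm q * ρm q) * ∑ i, u q i ^ 2
          + αp q * ρp q ^ γp / (γp - 1) + αm q * ρm q ^ γm / (γm - 1))) p
      = ∑ i, u p i * pd i (fun q => (αp q * lamp + αm q * lamm) * divg u q) p
        - ∑ i, u p i * pd i (fun q => αp q * ρp q ^ γp + αm q * ρm q ^ γm) p
        - (∑ j, u p j * pd j (fun q =>
            1 / 2 * (αp q * ρp q + αm q * ρm q) * ∑ i, u q i ^ 2) p
          + ∑ i, u p i * pd i (fun q => αp q * ρp q ^ γp / (γp - 1)) p
          + ∑ i, u p i * pd i (fun q => αm q * ρm q ^ γm / (γm - 1)) p) := by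
    simp only [← Finset.sum_add_distrib, ← Finset.sum_sub_distrib]
    refine Finset.sum_congr rfl fun j _ => ?_
    rw [pd_sub j (D (hls.sub (hpp.add hpm))) (D hEs), pd_sub j (D hls) (D (hpp.add hpm)),
      pd_add j (D (hKs.add (hpp.div_const _))) (D (hpm.div_const _)),
      pd_add j (D hKs) (D (hpp.div_const _))]
    ring
  rw [hflux (fun j => D (hSs j)) (D hWs), hW,
    pt_add (D (hKs.add (hpp.div_const _))) (D (hpm.div_const _)),
    pt_add (D hKs) (D (hpp.div_const _))]
  linear_combination hK + hIp + hIm + hmom' + 2 * hS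
end
end

section
/- Derivation of the divergence constraint (equation (fordivu) of the paper). Let d ≥ 1 and γ₊, γ₋ > 1. Let C : ℝ → (0,∞) be C¹, let α₊, α₋ : ℝ × ℝ^d → ℝ be C¹ with α₊ + α₋ = 1, and let u : ℝ × ℝ^d → ℝ^d be C¹. Define ρ±(t,x) := C(t)^{1/γ±}. If ∂ₜ(α₊ρ₊) + div(α₊ρ₊u) = 0 and ∂ₜ(α₋ρ₋) + div(α₋ρ₋u) = 0, then pointwise (α₊/γ₊ + α₋/γ₋)·C′(t)/C(t) + div u = 0. -/
open MeasureTheory Real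

noncomputable section

/-- The mass equation of a phase with density `C(t)^r`, in nonconservative form. -/
theorem mass_equation_nonconservative {d : ℕ} (r : ℝ) (C : ℝ → ℝ) (a : Pt d → ℝ)
    (u : Pt d → Fin d → ℝ) (p : Pt d) (hCpos : 0 < C p.1) (hC : DifferentiableAt ℝ C p.1)
    (ha : DifferentiableAt ℝ a p) (hu : DifferentiableAt ℝ u p)
    (hmass : pt (fun q => a q * C q.1 ^ r) p
      + divg (fun q j => a q * C q.1 ^ r * u q j) p = 0) :
    pt a p + a p * r * (deriv C p.1 / C p.1) + ∑ i, pd i a p * u p i + a p * divg u p = 0 := by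
  have hρ : HasFDerivAt (fun q : Pt d => C q.1 ^ r)
      ((deriv C p.1 * r * C p.1 ^ (r - 1)) • ContinuousLinearMap.fst ℝ ℝ (Fin d → ℝ)) p :=
    (hC.hasDerivAt.rpow_const (Or.inl hCpos.ne')).comp_hasFDerivAt p hasFDerivAt_fst
  have haρ := ha.hasFDerivAt.mul hρ
  have hui (i : Fin d) : DifferentiableAt ℝ (fun q => u q i) p := differentiableAt_pi.mp hu i
  have ht : pt (fun q => a q * C q.1 ^ r) p
      = C p.1 ^ r * (pt a p + a p * r * (deriv C p.1 / C p.1)) := by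
    have h : fderiv ℝ (fun q => a q * C q.1 ^ r) p = _ := haρ.fderiv
    simp only [pt, h]
    simp [Real.rpow_sub_one hCpos.ne']
    ring
  have hx (i : Fin d) : pd i (fun q => a q * C q.1 ^ r * u q i) p
      = C p.1 ^ r * (pd i a p * u p i + a p * pd i (fun q => u q i) p) := by
    have h : fderiv ℝ (fun q => a q * C q.1 ^ r * u q i) p = _ :=
      (haρ.mul (hui i).hasFDerivAt).fderiv
    simp only [pd, h]
    simp
    ring
  simp only [divg, hx, ht, ← Finset.mul_sum, ← mul_add, Finset.sum_add_distrib] at hmass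
  have h := (mul_eq_zero.mp hmass).resolve_left (Real.rpow_pos_of_pos hCpos r).ne'
  rw [divg]
  linarith

/-- derivation of the divergence constraint (equation (fordivu)).
With `ρ± = C(t)^{1/γ±}`, the two mass equations imply
`(α₊/γ₊ + α₋/γ₋) C'(t)/C(t) + div u = 0`. -/
theorem divergence_constraint_isentropic
    {d : ℕ} (hd : 1 ≤ d) (γp γm : ℝ) (hγp : 1 < γp) (hγm : 1 < γm)
    (C : ℝ → ℝ) (hCpos : ∀ t, 0 < C t) (hC : ContDiff ℝ 1 C)
    (αp αm : Pt d → ℝ) (hαp : ContDiff ℝ 1 αp) (hαm : ContDiff ℝ 1 αm)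
    (hα : ∀ p, αp p + αm p = 1)
    (u : Pt d → Fin d → ℝ) (hu : ContDiff ℝ 1 u)
    (hmassp : ∀ p : Pt d, pt (fun q => αp q * C q.1 ^ (1 / γp)) p
      + divg (fun q j => αp q * C q.1 ^ (1 / γp) * u q j) p = 0)
    (hmassm : ∀ p : Pt d, pt (fun q => αm q * C q.1 ^ (1 / γm)) p
      + divg (fun q j => αm q * C q.1 ^ (1 / γm) * u q j) p = 0) :
    ∀ p : Pt d,
      (αp p / γp + αm p / γm) * (deriv C p.1 / C p.1) + divg u p = 0 := by
  intro p
  have hdp := hαp.differentiable one_ne_zero p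
  have hdm := hαm.differentiable one_ne_zero p
  have hdC := hC.differentiable one_ne_zero p.1
  have hdu := hu.differentiable one_ne_zero p
  have hp := mass_equation_nonconservative (1 / γp) C αp u p (hCpos _) hdC hdp hdu (hmassp p)
  have hm := mass_equation_nonconservative (1 / γm) C αm u p (hCpos _) hdC hdm hdu (hmassm p)
  have hgrad : fderiv ℝ αm p = -fderiv ℝ αp p := by
    have h : αm = fun q => 1 - αp q := funext fun q => eq_sub_of_add_eq' (hα q)
    rw [h, fderiv_const_sub]
  simp only [pt, pd, hgrad, neg_apply, neg_mul, Finset.sum_neg_distrib] at hp hm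
  have hα' : αm p = 1 - αp p := eq_sub_of_add_eq' (hα p)
  rw [hα'] at hm ⊢
  linear_combination hp + hm
end
end

section
/- Time constancy of the leading-order pressure and divergence-free limit velocity. Let d ≥ 1 and γ₊, γ₋ > 1. Let C : ℝ → (0,∞) be C¹, let α₊, α₋ : ℝ × ℝ^d → ℝ be continuous ℤ^d-periodic functions with α₊ ≥ 0, α₋ ≥ 0 and α₊ + α₋ = 1, and let u : ℝ × ℝ^d → ℝ^d be a C¹ ℤ^d-periodic vector field such that pointwise (α₊/γ₊ + α₋/γ₋)·C′(t)/C(t) + div u = 0. Then C′(t) = 0 for all t (so C is constant) and div u = 0 everywhere. -/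
open MeasureTheory Real

noncomputable section

/-- The spatial divergence of a `C¹` field is continuous. -/
lemma continuous_divg {d : ℕ} {u : Pt d → Fin d → ℝ} (hu : ContDiff ℝ 1 u) :
    Continuous (divg u) := by
  unfold divg pd
  refine continuous_finsetSum _ fun i _ => ?_
  exact (((contDiff_pi.1 hu i).continuous_fderiv one_ne_zero).clm_apply continuous_const)

/-- The divergence of a `C¹` periodic field has zero integral over the unit cell. -/
lemma setIntegral_divg_cell_eq_zero {d : ℕ} {u : Pt d → Fin d → ℝ} (hu : ContDiff ℝ 1 u)
    (huper : ZPeriodicVec u) (t : ℝ) : ∫ x in cell d, divg u (t, x) = 0 := by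
  cases d with
  | zero => simp [divg]
  | succ n =>
    have hui : ∀ i, ContDiff ℝ 1 fun q => u q i := contDiff_pi.1 hu
    have hc : Continuous fun x : Fin (n + 1) → ℝ => divg u (t, x) :=
      (continuous_divg hu).comp (by fun_prop)
    have key := integral_divergence_of_hasFDerivAt_off_countable' (0 : Fin (n + 1) → ℝ) 1
      zero_le_one (fun i x => u (t, x) i)
      (fun i x => (fderiv ℝ (fun q => u q i) (t, x)).comp
        (ContinuousLinearMap.inr ℝ ℝ (Fin (n + 1) → ℝ)))
      ∅ Set.countable_empty
      (fun i => ((hui i).continuous.comp (by fun_prop : Continuous fun x => (t, x))).continuousOn)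
      (fun x _ i => (((hui i).differentiable one_ne_zero) (t, x)).hasFDerivAt.comp x
        (hasFDerivAt_prodMk_right t x))
      (hc.continuousOn.integrableOn_compact isCompact_Icc)
    refine key.trans (Finset.sum_eq_zero fun i _ => sub_eq_zero.2 ?_)
    refine integral_congr_ae (Filter.Eventually.of_forall fun x => ?_)
    have h := huper i (Pi.single i 1) t (i.insertNth 0 x)
    have hx : (i.insertNth (0 : ℝ) x : Fin (n + 1) → ℝ)
        + (fun j => (((Pi.single i 1 : Fin (n + 1) → ℤ) j : ℤ) : ℝ)) = i.insertNth 1 x := by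
      ext j
      refine Fin.succAboveCases i ?_ (fun k => ?_) j <;> simp
    rw [hx] at h
    exact h

/-- A nonnegative pair of weights summing to one gives a convex combination bounded below by
the smaller of the two values. -/
lemma min_le_div_add_div {a b p q : ℝ} (ha : 0 ≤ a) (hb : 0 ≤ b) (hab : a + b = 1) :
    min (1 / p) (1 / q) ≤ a / p + b / q := by
  have h₁ := mul_le_mul_of_nonneg_left (min_le_left (1 / p) (1 / q)) ha
  have h₂ := mul_le_mul_of_nonneg_left (min_le_right (1 / p) (1 / q)) hb
  calc min (1 / p) (1 / q) = a * min (1 / p) (1 / q) + b * min (1 / p) (1 / q) := by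
        rw [← add_mul, hab, one_mul]
    _ ≤ a * (1 / p) + b * (1 / q) := add_le_add h₁ h₂
    _ = a / p + b / q := by rw [mul_one_div, mul_one_div]

/-- A continuous function bounded below by a positive constant has positive integral over the
unit cell. -/
lemma setIntegral_cell_pos {d : ℕ} {w : (Fin d → ℝ) → ℝ} (hw : Continuous w) {m : ℝ}
    (hm : 0 < m) (hmw : ∀ x, m ≤ w x) : 0 < ∫ x in cell d, w x := by
  have hvol : volume.real (cell d) = 1 := by
    simp [cell, measureReal_def, Real.volume_Icc_pi]
  have hK : IsCompact (cell d) := isCompact_Icc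
  calc 0 < m := hm
    _ = ∫ _ in cell d, m := by simp [hvol]
    _ ≤ ∫ x in cell d, w x :=
      integral_mono (continuousOn_const.integrableOn_compact hK)
        (hw.continuousOn.integrableOn_compact hK) hmw

/-- time constancy of the leading-order pressure and divergence-free
limit velocity: if pointwise `(α₊/γ₊ + α₋/γ₋) C'(t)/C(t) + div u = 0` with periodic
data, then `C' = 0` and `div u = 0`. -/
theorem pressure_constant_and_divergence_free
    {d : ℕ} (hd : 1 ≤ d) (γp γm : ℝ) (hγp : 1 < γp) (hγm : 1 < γm)
    (C : ℝ → ℝ) (hCpos : ∀ t, 0 < C t) (hC : ContDiff ℝ 1 C)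
    (αp αm : Pt d → ℝ) (hαpc : Continuous αp) (hαmc : Continuous αm)
    (hαpper : ZPeriodic αp) (hαmper : ZPeriodic αm)
    (hαppos : ∀ p, 0 ≤ αp p) (hαmpos : ∀ p, 0 ≤ αm p)
    (hα : ∀ p, αp p + αm p = 1)
    (u : Pt d → Fin d → ℝ) (hu : ContDiff ℝ 1 u) (huper : ZPeriodicVec u)
    (hrel : ∀ p : Pt d,
      (αp p / γp + αm p / γm) * (deriv C p.1 / C p.1) + divg u p = 0) :
    (∀ t, deriv C t = 0) ∧ (∀ p : Pt d, divg u p = 0) := by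
  have hC' : ∀ t, deriv C t = 0 := fun t => by
    have hw : Continuous fun x : Fin d → ℝ => αp (t, x) / γp + αm (t, x) / γm := by fun_prop
    have hpos : 0 < ∫ x in cell d, (αp (t, x) / γp + αm (t, x) / γm) :=
      setIntegral_cell_pos hw (m := min (1 / γp) (1 / γm))
        (lt_min (by positivity) (by positivity))
        fun x => min_le_div_add_div (hαppos _) (hαmpos _) (hα _)
    have hzero : (∫ x in cell d, (αp (t, x) / γp + αm (t, x) / γm)) * (deriv C t / C t) = 0 := by
      rw [← integral_mul_const, ← neg_eq_zero, ← integral_neg,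
        ← setIntegral_divg_cell_eq_zero hu huper t]
      exact integral_congr_ae (Filter.Eventually.of_forall fun x =>
        neg_eq_of_add_eq_zero_right (hrel (t, x)))
    exact (div_eq_zero_iff.1 ((mul_eq_zero.1 hzero).resolve_left hpos.ne')).resolve_right
      (hCpos t).ne'
  exact ⟨hC', fun p => by simpa [hC'] using hrel p⟩
end
end

section
/- Derivation of the averaged divergence constraint in the non-isentropic two-velocity case (equation (divuI2) of the paper). Let d ≥ 1 and γ₊, γ₋ > 1. Let C : ℝ → (0,∞) be C¹, let α₊, α₋, S₊, S₋ : ℝ × ℝ^d → ℝ be C¹ with α₊ + α₋ = 1, and let u₊, u₋ : ℝ × ℝ^d → ℝ^d be C¹. Define ρ±(t,x) := C(t)^{1/γ±} e^{−S±(t,x)/γ±}. If ∂ₜS± + u±·∇S± = 0 and ∂ₜ(α±ρ±) + div(α±ρ±u±) = 0 for both phases, then pointwise div(α₊u₊ + α₋u₋) + (α₊/γ₊ + α₋/γ₋)·C′(t)/C(t) = 0. -/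
open MeasureTheory Real

noncomputable section

/-- Differential of the density `C(t)^{1/γ} e^{-S/γ}`. -/
lemma hasFDerivAt_density {d : ℕ} (γ : ℝ) {C : ℝ → ℝ} {S : Pt d → ℝ} {p : Pt d}
    (hCpos : 0 < C p.1) (hC : DifferentiableAt ℝ C p.1) (hS : DifferentiableAt ℝ S p) :
    HasFDerivAt (fun q : Pt d => C q.1 ^ (1 / γ) * Real.exp (-S q / γ))
      ((C p.1 ^ (1 / γ) * Real.exp (-S p / γ)) •
        ((deriv C p.1 / C p.1 / γ) • ContinuousLinearMap.fst ℝ ℝ (Fin d → ℝ)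
          - γ⁻¹ • fderiv ℝ S p)) p := by
  have h1 : HasFDerivAt (fun q : Pt d => C q.1 ^ (1 / γ))
      ((deriv C p.1 * (1 / γ) * C p.1 ^ (1 / γ - 1)) •
        ContinuousLinearMap.fst ℝ ℝ (Fin d → ℝ)) p :=
    (hC.hasDerivAt.rpow_const (p := 1 / γ) (Or.inl hCpos.ne')).comp_hasFDerivAt p hasFDerivAt_fst
  have h2 : HasFDerivAt (fun q : Pt d => Real.exp (-S q / γ))
      (Real.exp (-S p / γ) • (γ⁻¹ • -fderiv ℝ S p)) p := by
    have h := (hS.hasFDerivAt.neg.const_mul γ⁻¹).exp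
    simpa only [Pi.neg_apply, div_eq_inv_mul] using h
  refine (h1.mul h2).congr_fderiv ?_
  ext v <;>
  · simp [Real.rpow_sub_one hCpos.ne']
    ring

/-- Entropy transport and mass conservation of a single phase yield an equation for its volume
fraction alone. -/
lemma volume_fraction_equation {d : ℕ} {γ : ℝ} {C : ℝ → ℝ} {α S : Pt d → ℝ}
    {u : Pt d → Fin d → ℝ} {p : Pt d}
    (hCpos : 0 < C p.1) (hC : DifferentiableAt ℝ C p.1) (hα : DifferentiableAt ℝ α p)
    (hS : DifferentiableAt ℝ S p) (hu : DifferentiableAt ℝ u p)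
    (hent : pt S p + ∑ i, u p i * pd i S p = 0)
    (hmass : pt (fun q => α q * (C q.1 ^ (1 / γ) * Real.exp (-S q / γ))) p
      + divg (fun q j => α q * (C q.1 ^ (1 / γ) * Real.exp (-S q / γ)) * u q j) p = 0) :
    pt α p + divg (fun q j => α q * u q j) p + α p / γ * (deriv C p.1 / C p.1) = 0 := by
  have hρ := hasFDerivAt_density γ hCpos hC hS
  have hui (i : Fin d) : DifferentiableAt ℝ (fun q => u q i) p := differentiableAt_pi.1 hu i
  have hρpos : 0 < C p.1 ^ (1 / γ) * Real.exp (-S p / γ) := by positivity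
  have ht : pt (fun q => α q * (C q.1 ^ (1 / γ) * Real.exp (-S q / γ))) p
      = (C p.1 ^ (1 / γ) * Real.exp (-S p / γ)) *
        (pt α p + α p / γ * (deriv C p.1 / C p.1) - α p / γ * pt S p) := by
    simp only [pt]
    rw [(hα.hasFDerivAt.fun_mul hρ).fderiv]
    simp
    ring
  have hx (i : Fin d) : pd i (fun q => α q * (C q.1 ^ (1 / γ) * Real.exp (-S q / γ)) * u q i) p
      = (C p.1 ^ (1 / γ) * Real.exp (-S p / γ)) *
        (pd i (fun q => α q * u q i) p - α p / γ * (u p i * pd i S p)) := by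
    simp only [pd]
    rw [((hα.hasFDerivAt.fun_mul hρ).fun_mul (hui i).hasFDerivAt).fderiv,
      (hα.hasFDerivAt.fun_mul (hui i).hasFDerivAt).fderiv]
    simp
    ring
  simp only [divg] at hmass ⊢
  rw [ht, Finset.sum_congr rfl fun i _ => hx i, ← Finset.mul_sum, Finset.sum_sub_distrib,
    ← Finset.mul_sum, ← mul_add] at hmass
  have h := (mul_eq_zero.1 hmass).resolve_left hρpos.ne'
  linear_combination h + α p / γ * hent

/-- averaged divergence constraint in the non-isentropic two-velocity
case (equation (divuI2)). With `ρ± = C(t)^{1/γ±} e^{-S±/γ±}`, per-phase entropy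
transport and mass equations imply
`div(α₊u₊ + α₋u₋) + (α₊/γ₊ + α₋/γ₋) C'/C = 0`. -/
theorem divergence_constraint_nonisentropic_two_velocity
    {d : ℕ} (hd : 1 ≤ d) (γp γm : ℝ) (hγp : 1 < γp) (hγm : 1 < γm)
    (C : ℝ → ℝ) (hCpos : ∀ t, 0 < C t) (hC : ContDiff ℝ 1 C)
    (αp αm Sp Sm : Pt d → ℝ)
    (hαp : ContDiff ℝ 1 αp) (hαm : ContDiff ℝ 1 αm)
    (hSp : ContDiff ℝ 1 Sp) (hSm : ContDiff ℝ 1 Sm)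
    (hα : ∀ p, αp p + αm p = 1)
    (up um : Pt d → Fin d → ℝ) (hup : ContDiff ℝ 1 up) (hum : ContDiff ℝ 1 um)
    (hentp : ∀ p : Pt d, pt Sp p + ∑ i, up p i * pd i Sp p = 0)
    (hentm : ∀ p : Pt d, pt Sm p + ∑ i, um p i * pd i Sm p = 0)
    (hmassp : ∀ p : Pt d,
      pt (fun q => αp q * (C q.1 ^ (1 / γp) * Real.exp (-Sp q / γp))) p
      + divg (fun q j => αp q * (C q.1 ^ (1 / γp) * Real.exp (-Sp q / γp)) * up q j) p = 0)
    (hmassm : ∀ p : Pt d,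
      pt (fun q => αm q * (C q.1 ^ (1 / γm) * Real.exp (-Sm q / γm))) p
      + divg (fun q j => αm q * (C q.1 ^ (1 / γm) * Real.exp (-Sm q / γm)) * um q j) p = 0) :
    ∀ p : Pt d,
      divg (fun q j => αp q * up q j + αm q * um q j) p
        + (αp p / γp + αm p / γm) * (deriv C p.1 / C p.1) = 0 := by
  intro p
  have dαp := hαp.differentiable one_ne_zero p
  have dαm := hαm.differentiable one_ne_zero p
  have dup := hup.differentiable one_ne_zero p
  have dum := hum.differentiable one_ne_zero p
  have dC := hC.differentiable one_ne_zero p.1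
  have ep := volume_fraction_equation (hCpos p.1) dC dαp
    (hSp.differentiable one_ne_zero p) dup (hentp p) (hmassp p)
  have em := volume_fraction_equation (hCpos p.1) dC dαm
    (hSm.differentiable one_ne_zero p) dum (hentm p) (hmassm p)
  have hsum : pt αp p + pt αm p = 0 := by
    have h : (fun q => αp q + αm q) = fun _ => (1 : ℝ) := funext hα
    simp only [pt]
    rw [← add_apply, ← fderiv_fun_add dαp dαm, h]
    simp
  have hdiv : divg (fun q j => αp q * up q j + αm q * um q j) p
      = divg (fun q j => αp q * up q j) p + divg (fun q j => αm q * um q j) p := by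
    simp only [divg, pd, ← Finset.sum_add_distrib]
    refine Finset.sum_congr rfl fun i _ => ?_
    rw [fderiv_fun_add (dαp.fun_mul (differentiableAt_pi.1 dup i))
      (dαm.fun_mul (differentiableAt_pi.1 dum i)), add_apply]
  rw [hdiv]
  linear_combination ep + em - hsum
end
end
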